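/- Let φ : (X,a) ⇸ (Y,b) be a V-module, X̂ the V-category of V-functors X^op → V with structure 1_{X̂}^*(t,s) = ⋀_{x∈X} (t(x) ⊸ s(x)), y_X : X → X̂ the Yoneda functor y_X(x) = a(−,x), and y_φ : Y → X̂ the Yoneda mate y_φ(y) = φ(−,y). Then the lax extension of the Hausdorff functor, H̃φ(A,B) := ⋁_{D ⊆ X̂} h_{X̂}(y_X(A), D) ⊗ h_{X̂}(D, y_φ(B)), satisfies H̃φ(A,B) = ⋀_{x∈A} ⋁_{y∈B} φ(x,y) for all A ⊆ X, B ⊆ Y. -/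

import Mathlib

universe u v

/-- A commutative unital quantale: a complete lattice with a commutative monoid
structure whose multiplication preserves arbitrary suprema in each variable,
and whose unit `k = 1` satisfies `⊥ < 1`. -/
class CommQuantale (V : Type u) extends CompleteLattice V, CommMonoid V where
  mul_sSup : ∀ (a : V) (s : Set V), a * sSup s = ⨆ b ∈ s, a * b
  bot_lt_one : (⊥ : V) < 1

variable {V : Type u} [CommQuantale V]

/-- The internal hom `x ⊸ y` of the quantale, characterized by `z ≤ x ⊸ y ↔ z * x ≤ y`. -/
def qhom (x y : V) : V := sSup {z : V | z * x ≤ y}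

/-- `a : X → X → V` is a `V`-category structure. -/
def IsVCat {X : Type*} (a : X → X → V) : Prop :=
  (∀ x, (1 : V) ≤ a x x) ∧ (∀ x y z, a x y * a y z ≤ a x z)

/-- `f` is a `V`-functor from `(X,a)` to `(Y,b)`. -/
def IsVFun {X Y : Type*} (a : X → X → V) (b : Y → Y → V) (f : X → Y) : Prop :=
  ∀ x y, a x y ≤ b (f x) (f y)

/-- `φ` is a `V`-module from `(X,a)` to `(Y,b)`. -/
def IsVMod {X Y : Type*} (a : X → X → V) (b : Y → Y → V) (φ : X → Y → V) : Prop :=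
  (∀ x' x y, a x' x * φ x y ≤ φ x' y) ∧ (∀ x y y', φ x y * b y y' ≤ φ x y')

/-- The Hausdorff formula: for `φ = a` this is the Hausdorff structure `h_X` on `P X`;
for a `V`-module `φ` it is the lax (Hausdorff) extension `H̃φ`. -/
def hf {X Y : Type*} (φ : X → Y → V) (A : Set X) (B : Set Y) : V :=
  ⨅ x ∈ A, ⨆ y ∈ B, φ x y

/-- Module composition: `mcomp φ ψ` is `ψ · φ` in the paper's notation. -/
def mcomp {X Y Z : Type*} (φ : X → Y → V) (ψ : Y → Z → V) : X → Z → V :=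
  fun x z => ⨆ y, φ x y * ψ y z

/-- The Gromov–Hausdorff "distance": the join of `H̃φ(X,Y)` over all `V`-modules
`φ : X ⇸ Y`. -/
def GH {X Y : Type*} (a : X → X → V) (b : Y → Y → V) : V :=
  ⨆ φ : {φ : X → Y → V // IsVMod a b φ}, hf φ.1 Set.univ Set.univ

/-- `X̂`: the V-category of V-functors `X^op → V`. -/
def Xhat {X : Type*} (a : X → X → V) : Type _ :=
  {t : X → V // ∀ p q, a q p * t p ≤ t q}

/-- The structure `1_{X̂}^*(t,s) = ⋀_x (t(x) ⊸ s(x))` on `X̂`. -/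
def hatHom {X : Type*} (a : X → X → V) (t s : Xhat a) : V :=
  ⨅ x, qhom (t.1 x) (s.1 x)

/-- The Yoneda functor `y_X : X → X̂`, `x ↦ a(−,x)`. -/
def yonX {X : Type*} (a : X → X → V) (ha : IsVCat a) : X → Xhat a :=
  fun x => ⟨fun x' => a x' x, fun p q => ha.2 q p x⟩

/-- The Yoneda mate `y_φ : Y → X̂`, `y_φ(y) = φ(−,y)`. -/
def ymate {X Y : Type*} {a : X → X → V} {b : Y → Y → V} (φ : X → Y → V)
    (hφ : IsVMod a b φ) : Y → Xhat a :=
  fun y => ⟨fun x => φ x y, fun p q => hφ.1 q p y⟩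

theorem aux_mul_le_left (c : V) {x y : V} (h : x ≤ y) : c * x ≤ c * y := by
  have e := CommQuantale.mul_sSup c {x, y}
  have hs : sSup {x, y} = y := by rw [sSup_pair]; exact sup_eq_right.2 h
  rw [hs] at e
  rw [e]
  exact le_iSup₂_of_le x (by simp) le_rfl

theorem aux_mul_le {x y z w : V} (h : x ≤ y) (h' : z ≤ w) : x * z ≤ y * w := by
  refine (aux_mul_le_left x h').trans ?_
  rw [mul_comm x, mul_comm y]
  exact aux_mul_le_left w h

theorem aux_mul_iSup_le {ι : Type*} (S : Set ι) (c r : V) (f : ι → V)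
    (h : ∀ i ∈ S, c * f i ≤ r) : c * (⨆ i ∈ S, f i) ≤ r := by
  rw [← sSup_image, CommQuantale.mul_sSup]
  refine iSup₂_le ?_
  rintro _ ⟨i, hi, rfl⟩
  exact h i hi

theorem aux_qhom_mul (x y : V) : qhom x y * x ≤ y := by
  unfold qhom
  rw [mul_comm, CommQuantale.mul_sSup]
  refine iSup₂_le fun z hz => ?_
  rw [mul_comm]
  exact hz

theorem aux_le_qhom {x y z : V} (h : z * x ≤ y) : z ≤ qhom x y := le_sSup h

theorem aux_hat_mul {X : Type*} (a : X → X → V) (t s : Xhat a) (x : X) :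
    hatHom a t s * t.1 x ≤ s.1 x :=
  (aux_mul_le (iInf_le _ x) le_rfl).trans (aux_qhom_mul _ _)

theorem aux_yon_le {X : Type*} (a : X → X → V) (ha : IsVCat a) (d : Xhat a) (x : X) :
    hatHom a (yonX a ha x) d ≤ d.1 x := by
  have h := aux_hat_mul a (yonX a ha x) d x
  have h2 := aux_mul_le_left (hatHom a (yonX a ha x) d) (ha.1 x)
  rw [mul_one] at h2
  exact h2.trans h

theorem aux_le_yon {X : Type*} (a : X → X → V) (ha : IsVCat a) (d : Xhat a) (x : X) :
    d.1 x ≤ hatHom a (yonX a ha x) d := by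
  refine le_iInf fun q => aux_le_qhom ?_
  rw [mul_comm]
  exact d.2 x q

/-- the lax extension of the Hausdorff functor,
`H̃φ(A,B) = ⋁_{D ⊆ X̂} h_{X̂}(y_X(A), D) ⊗ h_{X̂}(D, y_φ(B))`, satisfies
`H̃φ(A,B) = ⋀_{x∈A} ⋁_{y∈B} φ(x,y)`. -/
theorem hausdorff_extension_formula {X Y : Type*} (a : X → X → V) (b : Y → Y → V)
    (ha : IsVCat a) (hb : IsVCat b) (φ : X → Y → V) (hφ : IsVMod a b φ)
    (A : Set X) (B : Set Y) :
    (⨆ D : Set (Xhat a),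
        hf (hatHom a) (yonX a ha '' A) D * hf (hatHom a) D (ymate φ hφ '' B))
      = ⨅ x ∈ A, ⨆ y ∈ B, φ x y := by
  apply le_antisymm
  · refine iSup_le fun D => le_iInf₂ fun x hx => ?_
    have h1 : hf (hatHom a) (yonX a ha '' A) D ≤ ⨆ d ∈ D, hatHom a (yonX a ha x) d :=
      iInf₂_le (yonX a ha x) (Set.mem_image_of_mem _ hx)
    refine (aux_mul_le h1 le_rfl).trans ?_
    rw [mul_comm]
    refine aux_mul_iSup_le D _ _ _ fun d hd => ?_
    have h2 : hf (hatHom a) D (ymate φ hφ '' B)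
        ≤ ⨆ e ∈ ymate φ hφ '' B, hatHom a d e := iInf₂_le d hd
    refine (aux_mul_le h2 (aux_yon_le a ha d x)).trans ?_
    rw [mul_comm]
    refine aux_mul_iSup_le _ _ _ _ ?_
    rintro _ ⟨y, hy, rfl⟩
    rw [mul_comm]
    exact (aux_hat_mul a d _ x).trans (le_iSup₂_of_le y hy le_rfl)
  · refine le_iSup_of_le (yonX a ha '' A) ?_
    have h1 : (1 : V) ≤ hf (hatHom a) (yonX a ha '' A) (yonX a ha '' A) := by
      refine le_iInf₂ ?_
      rintro _ ⟨x, hx, rfl⟩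
      refine le_iSup₂_of_le (yonX a ha x) (Set.mem_image_of_mem _ hx) ?_
      exact (ha.1 x).trans (aux_le_yon a ha (yonX a ha x) x)
    have h2 : (⨅ x ∈ A, ⨆ y ∈ B, φ x y)
        ≤ hf (hatHom a) (yonX a ha '' A) (ymate φ hφ '' B) := by
      refine le_iInf₂ ?_
      rintro _ ⟨x, hx, rfl⟩
      refine (iInf₂_le x hx).trans (iSup₂_le fun y hy => ?_)
      refine le_iSup₂_of_le (ymate φ hφ y) (Set.mem_image_of_mem _ hy) ?_
      exact aux_le_yon a ha (ymate φ hφ y) x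
    have h3 := aux_mul_le h1 h2
    rwa [one_mul] at h3
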